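/- Let $\mathbb{F}_q$ be a finite field, $l \geq 1$, $\mathcal{R} := \mathbb{F}_q^l$ the product ring, and $n \geq 1$. Let $\mathcal{C}$ be an $\mathcal{R}$-submodule of $\mathcal{R}^n$ and for $1 \le i \le l$ let $\mathcal{C}_i := \tilde{\pi}_i(\mathcal{C}) \subseteq \mathbb{F}_q^n$. Then $\mathcal{C}^{\perp} \subseteq \mathcal{C}$ if and only if $\mathcal{C}_i^{\perp} \subseteq \mathcal{C}_i$ for every $1 \le i \le l$, where $\mathcal{C}^{\perp}$ is the Euclidean dual with respect to the $\mathcal{R}$-valued inner product $\langle x, c \rangle_E = \sum_{j=0}^{n-1} x_j c_j \in \mathcal{R}$, and $\mathcal{C}_i^{\perp}$ is the Euclidean dual in $\mathbb{F}_q^n$ with respect to the standard dot product. -/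

import Mathlib

/-- Membership in a submodule over a finite product of rings can be checked one factor at a time. -/
theorem Submodule.mem_of_forall_exists_proj_eq {R ι κ : Type*} [Semiring R] [Fintype ι]
    (C : Submodule (ι → R) (κ → ι → R)) {x : κ → ι → R}
    (h : ∀ i, ∃ d ∈ C, ∀ k, d k i = x k i) : x ∈ C := by
  classical
  choose d hd hdx using h
  have hx : x = ∑ i, (Pi.single i 1 : ι → R) • d i := by
    ext k i
    simp [Finset.sum_apply, Pi.single_apply, hdx]
  rw [hx]
  exact C.sum_mem fun i _ => C.smul_mem _ (hd i)


/-- For an `R`-submodule `C ⊆ R^n` (`R = F^l`) with projections `Cᵢ = π̃ᵢ(C) ⊆ F^n`,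
the code `C` is Euclidean dual-containing (`C^⊥ ⊆ C`, with respect to the `R`-valued
inner product) if and only if every `Cᵢ` is Euclidean dual-containing in `F^n`
(with respect to the standard dot product). -/
theorem stmt14 {F : Type*} [Field F] [Fintype F] (l n : ℕ) (hl : 1 ≤ l) (hn : 1 ≤ n)
    (C : Submodule (Fin l → F) (Fin n → Fin l → F)) :
    ({x : Fin n → Fin l → F | ∀ c ∈ C, ∑ j, x j * c j = 0} ⊆ (C : Set _)) ↔
      ∀ i : Fin l,
        {v : Fin n → F |
            ∀ w ∈ (fun (d : Fin n → Fin l → F) (k : Fin n) => d k i) '' (C : Set _),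
              ∑ j, v j * w j = 0} ⊆
          (fun (d : Fin n → Fin l → F) (k : Fin n) => d k i) '' (C : Set _) := by
  constructor
  · intro h i v hv
    refine ⟨fun k => Pi.single i (v k), h fun c hc => ?_, by simp⟩
    ext i'
    rcases eq_or_ne i' i with rfl | hi
    · simpa [Finset.sum_apply] using hv _ ⟨c, hc, rfl⟩
    · simp [Finset.sum_apply, hi]
  · intro h x hx
    refine C.mem_of_forall_exists_proj_eq fun i => ?_
    have hxi : (fun k => x k i) ∈
        (fun (d : Fin n → Fin l → F) (k : Fin n) => d k i) '' (C : Set _) := by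
      refine h i ?_
      rintro _ ⟨c, hc, rfl⟩
      simpa [Finset.sum_apply] using congrFun (hx c hc) i
    obtain ⟨d, hd, hdx⟩ := hxi
    exact ⟨d, hd, congrFun hdx⟩
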